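/- arXiv:1909.08781 — 4 statements merged into one kernel-verified Lean document; each statement's English description precedes it below -/
import Mathlib

section
/- Let 0 < ρ < R. Then (R³ − ρ³)(k1(ρ)i0(R) + i1(ρ)k0(R)) > 3R²(k1(ρ)i1(R) − i1(ρ)k1(R)). Consequently, for any σ̲ > 0, σ̃ := (3R²/(R³ − ρ³))·(2σ̲ρ²/π)·(k1(ρ)i1(R) − i1(ρ)k1(R)) satisfies σ̃ < σ_s(R) := (2/π)σ̲ρ²(k1(ρ)i0(R) + i1(ρ)k0(R)). -/
/-- Modified spherical Bessel function `i₀(s) = sinh s / s`. -/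
noncomputable def i0 (s : ℝ) : ℝ := Real.sinh s / s

/-- Modified spherical Bessel function `i₁(s) = cosh s / s - sinh s / s²`. -/
noncomputable def i1 (s : ℝ) : ℝ := Real.cosh s / s - Real.sinh s / s ^ 2

/-- Modified spherical Bessel function `k₀(s) = (π/2) e^{-s} / s`. -/
noncomputable def k0 (s : ℝ) : ℝ := (Real.pi / 2) * Real.exp (-s) / s

/-- Modified spherical Bessel function `k₁(s) = (π/2) e^{-s} (1/s + 1/s²)`. -/
noncomputable def k1 (s : ℝ) : ℝ := (Real.pi / 2) * Real.exp (-s) * (1 / s + 1 / s ^ 2)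
theorem aux_pos (a : ℝ) (f f' : ℝ → ℝ) (hf : ∀ x, HasDerivAt f (f' x) x) (h0 : f a = 0)
    (hp : ∀ x, a < x → 0 < f' x) : ∀ x, a < x → 0 < f x := by
  intro x hx
  have hm : StrictMonoOn f (Set.Ici a) := by
    apply strictMonoOn_of_deriv_pos (convex_Ici a)
    · exact fun y _ => (hf y).continuousAt.continuousWithinAt
    · intro y hy
      rw [interior_Ici] at hy
      rw [(hf y).deriv]
      exact hp y hy
  have := hm (Set.mem_Ici.2 le_rfl) (Set.mem_Ici.2 hx.le) hx
  rwa [h0] at this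

theorem aux_main (ρ : ℝ) (hρ : 0 < ρ) (A B : ℝ → ℝ) (hA : ∀ x, HasDerivAt A (B x) x)
    (hB : ∀ x, HasDerivAt B (A x) x) (hA0 : A ρ = ρ) (hB0 : B ρ = 1)
    (pA : ∀ x, ρ < x → 0 < A x) (pB : ∀ x, ρ < x → 0 < B x) :
    ∀ x, ρ < x → 0 < (x ^ 3 - ρ ^ 3) * A x - 3 * x * (x * B x - A x) := by
  have hi := fun x : ℝ => hasDerivAt_id' x
  have hc : ∀ x : ℝ, HasDerivAt (fun x : ℝ => x ^ 3 - ρ ^ 3) (3 * x ^ 2) x := fun x => by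
    simpa using (hasDerivAt_pow 3 x).sub_const (ρ ^ 3)
  have c3 : ∀ x, ρ < x → 0 < x ^ 3 - ρ ^ 3 := fun x hx => by
    have : ρ ^ 3 < x ^ 3 := by gcongr
    linarith
  have h1 : ∀ x, ρ < x → 0 < x * B x - A x := by
    apply aux_pos ρ _ (fun x => x * A x)
    · intro x
      refine HasDerivAt.congr_deriv (((hi x).mul (hB x)).sub (hA x)) ?_
      ring
    · simp [hA0, hB0]
    · intro x hx
      exact mul_pos (hρ.trans hx) (pA x hx)
  have h1d : ∀ x, HasDerivAt (fun x => x * B x - A x) (x * A x) x := by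
    intro x
    refine HasDerivAt.congr_deriv (((hi x).mul (hB x)).sub (hA x)) ?_
    ring
  have h2 : ∀ x, ρ < x → 0 < (x ^ 3 - ρ ^ 3) * B x - 3 * (x * B x - A x) := by
    apply aux_pos ρ _ (fun x => (x ^ 3 - ρ ^ 3) * A x + 3 * x * (x * B x - A x))
    · intro x
      refine HasDerivAt.congr_deriv (((hc x).mul (hB x)).sub ((h1d x).const_mul 3)) ?_
      ring
    · simp [hA0, hB0]
    · intro x hx
      have := pA x hx
      have := c3 x hx
      have := h1 x hx
      have := hρ.trans hx
      positivity
  apply aux_pos ρ _ (fun x => (x ^ 3 - ρ ^ 3) * B x - 3 * (x * B x - A x)) _ _ h2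
  · intro x
    refine HasDerivAt.congr_deriv (((hc x).mul (hA x)).sub (((hi x).const_mul 3).mul (h1d x))) ?_
    ring
  · simp [hA0, hB0]

theorem aux_key (ρ R : ℝ) (hρ : 0 < ρ) (hR : ρ < R) :
    0 < (R ^ 3 - ρ ^ 3) * (ρ * Real.cosh (R - ρ) + Real.sinh (R - ρ))
      - 3 * R * (R * (ρ * Real.sinh (R - ρ) + Real.cosh (R - ρ))
        - (ρ * Real.cosh (R - ρ) + Real.sinh (R - ρ))) := by
  have hd : ∀ x : ℝ, HasDerivAt (fun x : ℝ => x - ρ) 1 x := fun x => (hasDerivAt_id' x).sub_const ρ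
  apply aux_main ρ hρ (fun x => ρ * Real.cosh (x - ρ) + Real.sinh (x - ρ))
    (fun x => ρ * Real.sinh (x - ρ) + Real.cosh (x - ρ)) _ _ _ _ _ _ R hR
  · intro x
    refine HasDerivAt.congr_deriv (((hd x).cosh.const_mul ρ).add (hd x).sinh) ?_
    ring
  · intro x
    refine HasDerivAt.congr_deriv (((hd x).sinh.const_mul ρ).add (hd x).cosh) ?_
    ring
  · simp
  · simp
  · intro x hx
    have := Real.sinh_pos_iff.2 (sub_pos.2 hx)
    have := Real.cosh_pos (x - ρ)
    positivity
  · intro x hx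
    have := Real.sinh_pos_iff.2 (sub_pos.2 hx)
    have := Real.cosh_pos (x - ρ)
    positivity

theorem aux_e (x : ℝ) : Real.exp (-x) = Real.cosh x - Real.sinh x := (Real.cosh_sub_sinh x).symm

theorem aux_1 (ρ R : ℝ) (hρ : 0 < ρ) (hR : 0 < R) : k1 ρ * i0 R + i1 ρ * k0 R =
    Real.pi / 2 / (ρ ^ 2 * R) * (ρ * Real.cosh (R - ρ) + Real.sinh (R - ρ)) := by
  have h1 := Real.cosh_sq ρ
  have h2 := Real.cosh_sq R
  simp only [k1, i0, i1, k0, aux_e, Real.cosh_sub, Real.sinh_sub]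
  field_simp
  ring

theorem aux_2 (ρ R : ℝ) (hρ : 0 < ρ) (hR : 0 < R) : k1 ρ * i1 R - i1 ρ * k1 R =
    Real.pi / 2 / (ρ ^ 2 * R ^ 2) * (R * (ρ * Real.sinh (R - ρ) + Real.cosh (R - ρ))
        - (ρ * Real.cosh (R - ρ) + Real.sinh (R - ρ))) := by
  simp only [k1, i1, aux_e, Real.cosh_sub, Real.sinh_sub]
  field_simp
  ring

/-- For 0 < ρ < R, (R³−ρ³)(k₁(ρ)i₀(R)+i₁(ρ)k₀(R)) > 3R²(k₁(ρ)i₁(R)−i₁(ρ)k₁(R));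
consequently σ̃ < σ_s(R) for every σ̲ > 0. -/
theorem stmt_8 (ρ R : ℝ) (hρ : 0 < ρ) (hR : ρ < R) :
    (R ^ 3 - ρ ^ 3) * (k1 ρ * i0 R + i1 ρ * k0 R)
      > 3 * R ^ 2 * (k1 ρ * i1 R - i1 ρ * k1 R) ∧
    ∀ σl : ℝ, 0 < σl →
      (3 * R ^ 2 / (R ^ 3 - ρ ^ 3)) * (2 * σl * ρ ^ 2 / Real.pi)
          * (k1 ρ * i1 R - i1 ρ * k1 R)
        < (2 / Real.pi) * σl * ρ ^ 2 * (k1 ρ * i0 R + i1 ρ * k0 R) := by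
  have hR0 : 0 < R := hρ.trans hR
  have c3 : 0 < R ^ 3 - ρ ^ 3 := by
    have : ρ ^ 3 < R ^ 3 := by gcongr
    linarith
  have hpi := Real.pi_pos
  have main : (R ^ 3 - ρ ^ 3) * (k1 ρ * i0 R + i1 ρ * k0 R)
      > 3 * R ^ 2 * (k1 ρ * i1 R - i1 ρ * k1 R) := by
    rw [aux_1 ρ R hρ hR0, aux_2 ρ R hρ hR0]
    have hk := aux_key ρ R hρ hR
    have hc : 0 < Real.pi / 2 / (ρ ^ 2 * R) := by positivity
    have h := mul_pos hc hk
    have he : Real.pi / 2 / (ρ ^ 2 * R ^ 2) = Real.pi / 2 / (ρ ^ 2 * R) / R := by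
      field_simp
    rw [he]
    generalize Real.pi / 2 / (ρ ^ 2 * R) = c at *
    have h3 : ∀ X : ℝ, 3 * R ^ 2 * (c / R * X) = c * (3 * R * X) := fun X => by
      field_simp
    rw [h3]
    linarith
  refine ⟨main, fun σl hσ => ?_⟩
  generalize k1 ρ * i0 R + i1 ρ * k0 R = P at *
  generalize k1 ρ * i1 R - i1 ρ * k1 R = Q at *
  have hc : 0 < 2 / Real.pi * σl * ρ ^ 2 := by positivity
  have h : 3 * R ^ 2 * Q / (R ^ 3 - ρ ^ 3) < P := by
    rw [div_lt_iff₀ c3]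
    linarith
  have := mul_lt_mul_of_pos_left h hc
  calc _ = 2 / Real.pi * σl * ρ ^ 2 * (3 * R ^ 2 * Q / (R ^ 3 - ρ ^ 3)) := by ring
    _ < _ := this
end

section
/- Let μ > 0, σ̲ > 0, 0 < ρ < R, set σ_s(r) = (2/π)σ̲ρ²(k1(ρ)i0(r) + i1(ρ)k0(r)), σ̃ = (3R²/(R³ − ρ³))·σ_s'(R), and define p_s(r) = −μ(σ_s(r) − σ_s(R)) + (1/6)μσ̃(r² − R²) + (1/3)μσ̃ρ³(1/r − 1/R) + 1/R for ρ < r < R. Then p_s''(r) + (2/r)p_s'(r) = −μ(σ_s(r) − σ̃) for all r ∈ (ρ, R), and (extending p_s by the same formula to [ρ, R]) p_s'(ρ) = 0, p_s(R) = 1/R, and p_s'(R) = 0. -/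
lemma hd_i0 {r : ℝ} (h : r ≠ 0) : HasDerivAt i0 (i1 r) r := by
  have := (Real.hasDerivAt_sinh r).div (hasDerivAt_id r) h
  refine HasDerivAt.congr_deriv this ?_
  simp only [i1, id]; field_simp

lemma hd_i1 {r : ℝ} (h : r ≠ 0) : HasDerivAt i1 (i0 r - 2 / r * i1 r) r := by
  have := ((Real.hasDerivAt_cosh r).div (hasDerivAt_id r) h).sub
    ((Real.hasDerivAt_sinh r).div (hasDerivAt_pow 2 r) (pow_ne_zero 2 h))
  refine HasDerivAt.congr_deriv this ?_
  simp only [i1, i0, id]; field_simp; push_cast; ring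

lemma hd_e (r : ℝ) : HasDerivAt (fun s : ℝ => (Real.pi / 2) * Real.exp (-s))
    (-((Real.pi / 2) * Real.exp (-r))) r := by
  have := ((hasDerivAt_id r).neg.exp).const_mul (Real.pi / 2)
  refine HasDerivAt.congr_deriv this ?_
  simp

lemma hd_k0 {r : ℝ} (h : r ≠ 0) : HasDerivAt k0 (-k1 r) r := by
  have := (hd_e r).div (hasDerivAt_id r) h
  refine HasDerivAt.congr_deriv this ?_
  simp only [k1, id]; field_simp; ring

lemma hd_inv {r : ℝ} (h : r ≠ 0) : HasDerivAt (fun s : ℝ => 1 / s) (-(1 / r ^ 2)) r := by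
  simpa using hasDerivAt_inv h

lemma hd_inv2 {r : ℝ} (h : r ≠ 0) : HasDerivAt (fun s : ℝ => 1 / s ^ 2) (-(2 / r ^ 3)) r := by
  have := (hasDerivAt_const r (1 : ℝ)).div (hasDerivAt_pow 2 r) (pow_ne_zero 2 h)
  refine HasDerivAt.congr_deriv this ?_
  field_simp; push_cast; ring

lemma hd_k1 {r : ℝ} (h : r ≠ 0) : HasDerivAt k1 (-k0 r - 2 / r * k1 r) r := by
  have := (hd_e r).mul ((hd_inv h).add (hd_inv2 h))
  refine HasDerivAt.congr_deriv this ?_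
  simp only [k1, k0, Pi.add_apply]; field_simp; ring

/-- The radial pressure p_s satisfies p_s'' + (2/r)p_s' = −μ(σ_s − σ̃) on (ρ,R),
with p_s'(ρ) = 0, p_s(R) = 1/R, p_s'(R) = 0. -/
theorem stmt_11 (μ σl ρ R : ℝ) (hμ : 0 < μ) (hσ : 0 < σl) (hρ : 0 < ρ) (hR : ρ < R) :
    let σs : ℝ → ℝ := fun r => (2 / Real.pi) * σl * ρ ^ 2 * (k1 ρ * i0 r + i1 ρ * k0 r)
    let σt : ℝ := (3 * R ^ 2 / (R ^ 3 - ρ ^ 3)) * deriv σs R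
    let ps : ℝ → ℝ := fun r => -μ * (σs r - σs R) + (1 / 6) * μ * σt * (r ^ 2 - R ^ 2)
      + (1 / 3) * μ * σt * ρ ^ 3 * (1 / r - 1 / R) + 1 / R
    (∀ r ∈ Set.Ioo ρ R, deriv (deriv ps) r + (2 / r) * deriv ps r = -μ * (σs r - σt)) ∧
    deriv ps ρ = 0 ∧ ps R = 1 / R ∧ deriv ps R = 0 := by
  intro σs σt ps
  have hR0 : R ≠ 0 := (hρ.trans hR).ne'
  have hρ0 : ρ ≠ 0 := hρ.ne'
  have hne : R ^ 3 - ρ ^ 3 ≠ 0 := by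
    have : ρ ^ 3 < R ^ 3 := pow_lt_pow_left₀ hR hρ.le (by norm_num)
    linarith
  set C : ℝ := (2 / Real.pi) * σl * ρ ^ 2 with hC
  let d : ℝ → ℝ := fun r => C * (k1 ρ * i1 r + i1 ρ * (-k1 r))
  have hσs : ∀ r, r ≠ 0 → HasDerivAt σs (d r) r := fun r h =>
    (((hd_i0 h).const_mul (k1 ρ)).add ((hd_k0 h).const_mul (i1 ρ))).const_mul C
  have hdd : ∀ r, r ≠ 0 → HasDerivAt d (σs r - 2 / r * d r) r := fun r h => by
    have := (((hd_i1 h).const_mul (k1 ρ)).add ((hd_k1 h).neg.const_mul (i1 ρ))).const_mul C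
    refine HasDerivAt.congr_deriv this ?_
    simp only [σs, d]; ring
  have hσt : σt = (3 * R ^ 2 / (R ^ 3 - ρ ^ 3)) * d R := by
    simp only [σt, (hσs R hR0).deriv]
  clear_value σt
  let q : ℝ → ℝ := fun r => -μ * d r + (1 / 6) * μ * σt * (2 * r)
    + (1 / 3) * μ * σt * ρ ^ 3 * (-(1 / r ^ 2))
  have hps : ∀ r, r ≠ 0 → HasDerivAt ps (q r) r := fun r h => by
    have := (((((hσs r h).sub_const (σs R)).const_mul (-μ)).add
      (((hasDerivAt_pow 2 r).sub_const (R ^ 2)).const_mul ((1 / 6) * μ * σt))).add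
      (((hd_inv h).sub_const (1 / R)).const_mul ((1 / 3) * μ * σt * ρ ^ 3))).add_const (1 / R)
    refine HasDerivAt.congr_deriv this ?_
    simp [q]
  have hq : ∀ r, r ≠ 0 → HasDerivAt q (-μ * (σs r - 2 / r * d r) + (1 / 6) * μ * σt * (2 * 1)
      + (1 / 3) * μ * σt * ρ ^ 3 * (-(-(2 / r ^ 3)))) r := fun r h =>
    (((hdd r h).const_mul (-μ)).add
      (((hasDerivAt_id r).const_mul 2).const_mul ((1 / 6) * μ * σt))).add
      ((hd_inv2 h).neg.const_mul ((1 / 3) * μ * σt * ρ ^ 3))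
  refine ⟨?_, ?_, ?_, ?_⟩
  · rintro r ⟨h1, h2⟩
    have h : r ≠ 0 := (hρ.trans h1).ne'
    have he : deriv ps =ᶠ[nhds r] q := by
      filter_upwards [isOpen_ne.mem_nhds h] with x hx using (hps x hx).deriv
    rw [he.deriv_eq, (hq r h).deriv, (hps r h).deriv]
    simp only [q]
    field_simp
    ring
  · rw [(hps ρ hρ0).deriv]
    simp only [q, d]
    field_simp
    ring
  · simp [ps]
  · rw [(hps R hR0).deriv]
    simp only [q, hσt]
    field_simp
    ring
end

section
/- Let 0 < ρ < R. Then M_{1,0} < 0, where M_{1,0} = ((i1(R)k1(ρ) − i1(ρ)k1(R))/(R(R³ − ρ³)))·[3Rρ²(i0(R)k1(ρ) + i1(ρ)k0(R)) − 6ρ²(i1(R)k1(ρ) − i1(ρ)k1(R)) − (R³ + 2ρ³)(i0(ρ)k1(R) + i1(R)k0(ρ))]. -/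
lemma aux_pos_s14 (g g' : ℝ → ℝ) (h : ∀ x, HasDerivAt g (g' x) x) (h0 : g 0 = 0)
    (hp : ∀ x, 0 < x → 0 < g' x) (t : ℝ) (ht : 0 < t) : 0 < g t := by
  have hm : StrictMonoOn g (Set.Ici 0) := by
    apply strictMonoOn_of_deriv_pos (convex_Ici 0)
    · exact fun x _ => (h x).continuousAt.continuousWithinAt
    · intro x hx
      rw [interior_Ici] at hx
      rw [(h x).deriv]
      exact hp x hx
  have := hm (Set.mem_Ici.2 le_rfl) (Set.mem_Ici.2 ht.le) ht
  rwa [h0] at this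

lemma aux1 (t : ℝ) (ht : 0 < t) : 0 < t * Real.cosh t - Real.sinh t := by
  refine aux_pos_s14 (fun t => t * Real.cosh t - Real.sinh t) (fun t => t * Real.sinh t) ?_ ?_ ?_ t ht
  · intro x
    have := ((hasDerivAt_id x).mul (Real.hasDerivAt_cosh x)).sub (Real.hasDerivAt_sinh x)
    refine this.congr_deriv ?_
    simp
  · simp
  · intro x hx
    exact mul_pos hx (Real.sinh_pos_iff.2 hx)

lemma aux2 (t : ℝ) (ht : 0 < t) :
    0 < (4 * t ^ 3 + 6 * t) * Real.cosh t - (6 * t ^ 2 + 6) * Real.sinh t := by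
  refine aux_pos_s14 (fun t => (4 * t ^ 3 + 6 * t) * Real.cosh t - (6 * t ^ 2 + 6) * Real.sinh t)
    (fun t => 6 * t * (t * Real.cosh t - Real.sinh t) + 4 * t ^ 3 * Real.sinh t) ?_ ?_ ?_ t ht
  · intro x
    have h1 : HasDerivAt (fun t : ℝ => 4 * t ^ 3 + 6 * t) (12 * x ^ 2 + 6) x := by
      have := ((hasDerivAt_pow 3 x).const_mul 4).add ((hasDerivAt_id x).const_mul 6)
      refine this.congr_deriv ?_
      norm_num
      ring
    have h2 : HasDerivAt (fun t : ℝ => 6 * t ^ 2 + 6) (12 * x) x := by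
      have := ((hasDerivAt_pow 2 x).const_mul 6).add_const 6
      refine this.congr_deriv ?_
      norm_num
      ring
    have := (h1.mul (Real.hasDerivAt_cosh x)).sub (h2.mul (Real.hasDerivAt_sinh x))
    refine this.congr_deriv ?_
    ring
  · simp
  · intro x hx
    have := aux1 x hx
    have := Real.sinh_pos_iff.2 hx
    positivity

/-- M_{1,0} < 0. -/
theorem stmt_14 (ρ R : ℝ) (hρ : 0 < ρ) (hR : ρ < R) :
    ((i1 R * k1 ρ - i1 ρ * k1 R) / (R * (R ^ 3 - ρ ^ 3)))
      * (3 * R * ρ ^ 2 * (i0 R * k1 ρ + i1 ρ * k0 R)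
        - 6 * ρ ^ 2 * (i1 R * k1 ρ - i1 ρ * k1 R)
        - (R ^ 3 + 2 * ρ ^ 3) * (i0 ρ * k1 R + i1 R * k0 ρ)) < 0 := by
  have hR0 : 0 < R := hρ.trans hR
  have hpi := Real.pi_pos
  obtain ⟨t, ht⟩ : ∃ t, t = R - ρ := ⟨_, rfl⟩
  have htp : 0 < t := by linarith
  have hS : Real.sinh t = Real.sinh R * Real.cosh ρ - Real.cosh R * Real.sinh ρ := by
    rw [ht, Real.sinh_sub]
  have hC : Real.cosh t = Real.cosh R * Real.cosh ρ - Real.sinh R * Real.sinh ρ := by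
    rw [ht, Real.cosh_sub]
  have e1 : i1 R * k1 ρ - i1 ρ * k1 R = Real.pi / 2 *
      (R * ρ * Real.sinh t + (t * Real.cosh t - Real.sinh t)) / (R ^ 2 * ρ ^ 2) := by
    simp only [i1, k1, ← Real.cosh_sub_sinh]
    rw [hS, hC, ht]
    field_simp
    ring
  have e2 : i0 R * k1 ρ + i1 ρ * k0 R = Real.pi / 2 *
      (ρ * Real.cosh t + Real.sinh t) / (R * ρ ^ 2) := by
    simp only [i0, i1, k0, k1, ← Real.cosh_sub_sinh]
    rw [hS, hC]
    field_simp
    ring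
  have e3 : i0 ρ * k1 R + i1 R * k0 ρ = Real.pi / 2 *
      (R * Real.cosh t - Real.sinh t) / (ρ * R ^ 2) := by
    simp only [i0, i1, k0, k1, ← Real.cosh_sub_sinh]
    rw [hS, hC]
    field_simp
    ring
  have a1 := aux1 t htp
  have a2 := aux2 t htp
  have hs := Real.sinh_pos_iff.2 htp
  rw [e1, e2, e3]
  generalize Real.sinh t = S at *
  generalize Real.cosh t = C at *
  have hcube : 0 < R ^ 3 - ρ ^ 3 := sub_pos.2 (pow_lt_pow_left₀ hR hρ.le (by norm_num))
  apply mul_neg_of_pos_of_neg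
  · positivity
  · have hRe : R = ρ + t := by linarith
    have key : 3 * R * ρ ^ 2 * (Real.pi / 2 * (ρ * C + S) / (R * ρ ^ 2))
        - 6 * ρ ^ 2 * (Real.pi / 2 * (R * ρ * S + (t * C - S)) / (R ^ 2 * ρ ^ 2))
        - (R ^ 3 + 2 * ρ ^ 3) * (Real.pi / 2 * (R * C - S) / (ρ * R ^ 2))
        = -(Real.pi / 2 * (3 * ρ ^ 2 * t * (t * C - S)
          + ρ * ((4 * t ^ 3 + 6 * t) * C - (6 * t ^ 2 + 6) * S)
          + t ^ 3 * (t * C - S)) / (ρ * R ^ 2)) := by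
      field_simp
      rw [hRe]
      ring
    rw [key]
    apply neg_neg_of_pos
    positivity
end

section
/- Let R > 0 and define η(s) = [s⁴ − 8Rs³ + 6(R² + 1)s² + 2(R³ − 3R)s − R⁴]·sinh(2(R − s)) + [−2Rs⁴ + (3R² + 4)s³ − 12Rs² + (−R⁴ + 3R² + 3)s + 2R³]·cosh(2(R − s)) − (R² − 2)s³ + (3R⁴ + 3R² − 3)s − 2R⁵ − 2R³ for 0 < s ≤ R. Then η(R) = 0 and η(s) < 0 for every 0 < s < R. -/
lemma aux_neg (f f' : ℝ → ℝ) (h0 : f 0 = 0) (hd : ∀ x, HasDerivAt f (f' x) x)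
    (hn : ∀ x, 0 < x → f' x < 0) : ∀ x, 0 < x → f x < 0 := by
  have ha : StrictAntiOn f (Set.Ici 0) := by
    apply strictAntiOn_of_deriv_neg (convex_Ici 0)
    · exact fun x _ => (hd x).continuousAt.continuousWithinAt
    · intro x hx
      rw [interior_Ici] at hx
      rw [(hd x).deriv]
      exact hn x hx
  intro x hx
  have := ha (Set.mem_Ici.2 le_rfl) (Set.mem_Ici.2 hx.le) hx
  rwa [h0] at this

lemma aux_hd (p q r : ℝ → ℝ) (p' q' r' x : ℝ) (hp : HasDerivAt p (p') x)
    (hq : HasDerivAt q (q') x) (hr : HasDerivAt r (r') x) :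
    HasDerivAt (fun x => p x * Real.sinh x + q x * Real.cosh x + r x)
      ((p' + q x) * Real.sinh x + (p x + q') * Real.cosh x + r') x := by
  refine HasDerivAt.congr_deriv (((hp.mul (Real.hasDerivAt_sinh x)).add (hq.mul (Real.hasDerivAt_cosh x))).add hr) ?_
  ring

lemma aux_poly (a b c d e x : ℝ) : HasDerivAt (fun x : ℝ => a + b*x + c*x^2 + d*x^3 + e*x^4)
    (b + 2*c*x + 3*d*x^2 + 4*e*x^3) x := by
  have h1 := (hasDerivAt_id x).const_mul b
  have h2 := (hasDerivAt_pow 2 x).const_mul c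
  have h3 := (hasDerivAt_pow 3 x).const_mul d
  have h4 := (hasDerivAt_pow 4 x).const_mul e
  refine HasDerivAt.congr_deriv ((((h1.const_add a).add h2).add h3).add h4) ?_
  norm_num
  ring

lemma g3_neg (x : ℝ) (hx : 0 < x) : (-x)*Real.sinh x + (0)*Real.cosh x + (0) < 0 := by
  have h1 : 0 < Real.sinh x := Real.sinh_pos_iff.2 hx
  have h2 := Real.cosh_pos x
  nlinarith [mul_pos hx h1]

lemma g2_neg : ∀ x : ℝ, 0 < x → (1)*Real.sinh x + (-x)*Real.cosh x + (0) < 0 := by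
  refine aux_neg _ (fun x => (-x)*Real.sinh x + (0)*Real.cosh x + (0)) (by norm_num) (fun x => ?_) g3_neg
  have h := aux_hd _ _ _ _ _ _ x (aux_poly (1) (0) (0) (0) (0) x) (aux_poly (0) (-1) (0) (0) (0) x) (aux_poly (0) (0) (0) (0) (0) x)
  convert h using 1
  · funext y; ring
  · ring

lemma g1_neg : ∀ x : ℝ, 0 < x → (-x)*Real.sinh x + (2)*Real.cosh x + (-2) < 0 := by
  refine aux_neg _ (fun x => (1)*Real.sinh x + (-x)*Real.cosh x + (0)) (by norm_num) (fun x => ?_) g2_neg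
  have h := aux_hd _ _ _ _ _ _ x (aux_poly (0) (-1) (0) (0) (0) x) (aux_poly (2) (0) (0) (0) (0) x) (aux_poly (-2) (0) (0) (0) (0) x)
  convert h using 1
  · funext y; ring
  · ring

lemma g0_neg : ∀ x : ℝ, 0 < x → (3)*Real.sinh x + (-x)*Real.cosh x + (-2*x) < 0 := by
  refine aux_neg _ (fun x => (-x)*Real.sinh x + (2)*Real.cosh x + (-2)) (by norm_num) (fun x => ?_) g1_neg
  have h := aux_hd _ _ _ _ _ _ x (aux_poly (3) (0) (0) (0) (0) x) (aux_poly (0) (-1) (0) (0) (0) x) (aux_poly (0) (-2) (0) (0) (0) x)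
  convert h using 1
  · funext y; ring
  · ring

lemma h_neg : ∀ x : ℝ, 0 < x → (-x)*Real.sinh x + (4)*Real.cosh x + (-x^2-4) < 0 := by
  refine aux_neg _ (fun x => (3)*Real.sinh x + (-x)*Real.cosh x + (-2*x)) (by norm_num) (fun x => ?_) g0_neg
  have h := aux_hd _ _ _ _ _ _ x (aux_poly (0) (-1) (0) (0) (0) x) (aux_poly (4) (0) (0) (0) (0) x) (aux_poly (-4) (0) (-1) (0) (0) x)
  convert h using 1
  · funext y; ring
  · ring

lemma f6_neg (x : ℝ) (hx : 0 < x) : (-28*x^3-456*x)*Real.sinh x + (-x^4-216*x^2)*Real.cosh x + (0) < 0 := by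
  have h1 : 0 < Real.sinh x := Real.sinh_pos_iff.2 hx
  have h2 := Real.cosh_pos x
  have h3 : 0 < (28*x^3+456*x)*Real.sinh x := by positivity
  have h4 : 0 < (x^4+216*x^2)*Real.cosh x := by positivity
  linarith

lemma f5_neg : ∀ x : ℝ, 0 < x → (-x^4-144*x^2+168)*Real.sinh x + (-24*x^3-168*x)*Real.cosh x + (0) < 0 := by
  refine aux_neg _ (fun x => (-28*x^3-456*x)*Real.sinh x + (-x^4-216*x^2)*Real.cosh x + (0)) (by norm_num) (fun x => ?_) f6_neg
  have h := aux_hd _ _ _ _ _ _ x (aux_poly (168) (0) (-144) (0) (-1) x) (aux_poly (0) (-168) (0) (-24) (0) x) (aux_poly (0) (0) (0) (0) (0) x)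
  convert h using 1
  · funext y; ring
  · ring

lemma f4_neg : ∀ x : ℝ, 0 < x → (-20*x^3)*Real.sinh x + (-x^4-84*x^2+168)*Real.cosh x + (-168) < 0 := by
  refine aux_neg _ (fun x => (-x^4-144*x^2+168)*Real.sinh x + (-24*x^3-168*x)*Real.cosh x + (0)) (by norm_num) (fun x => ?_) f5_neg
  have h := aux_hd _ _ _ _ _ _ x (aux_poly (0) (0) (0) (-20) (0) x) (aux_poly (168) (0) (-84) (0) (-1) x) (aux_poly (-168) (0) (0) (0) (0) x)
  convert h using 1
  · funext y; ring
  · ring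

lemma f3_neg : ∀ x : ℝ, 0 < x → (-x^4-36*x^2+96)*Real.sinh x + (-16*x^3+72*x)*Real.cosh x + (-168*x) < 0 := by
  refine aux_neg _ (fun x => (-20*x^3)*Real.sinh x + (-x^4-84*x^2+168)*Real.cosh x + (-168)) (by norm_num) (fun x => ?_) f4_neg
  have h := aux_hd _ _ _ _ _ _ x (aux_poly (96) (0) (-36) (0) (-1) x) (aux_poly (0) (72) (0) (-16) (0) x) (aux_poly (0) (-168) (0) (0) (0) x)
  convert h using 1
  · funext y; ring
  · ring

lemma f2_neg : ∀ x : ℝ, 0 < x → (-12*x^3+72*x)*Real.sinh x + (-x^4+24)*Real.cosh x + (-84*x^2-24) < 0 := by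
  refine aux_neg _ (fun x => (-x^4-36*x^2+96)*Real.sinh x + (-16*x^3+72*x)*Real.cosh x + (-168*x)) (by norm_num) (fun x => ?_) f3_neg
  have h := aux_hd _ _ _ _ _ _ x (aux_poly (0) (72) (0) (-12) (0) x) (aux_poly (24) (0) (0) (0) (-1) x) (aux_poly (-24) (0) (-84) (0) (0) x)
  convert h using 1
  · funext y; ring
  · ring

lemma f1_neg : ∀ x : ℝ, 0 < x → (-x^4+24*x^2)*Real.sinh x + (-8*x^3+24*x)*Real.cosh x + (-28*x^3-24*x) < 0 := by
  refine aux_neg _ (fun x => (-12*x^3+72*x)*Real.sinh x + (-x^4+24)*Real.cosh x + (-84*x^2-24)) (by norm_num) (fun x => ?_) f2_neg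
  have h := aux_hd _ _ _ _ _ _ x (aux_poly (0) (0) (24) (0) (-1) x) (aux_poly (0) (24) (0) (-8) (0) x) (aux_poly (0) (-24) (0) (-28) (0) x)
  convert h using 1
  · funext y; ring
  · ring

lemma f0_neg : ∀ x : ℝ, 0 < x → (-(4*x^3+48*x))*Real.sinh x + (-x^4+36*x^2+48)*Real.cosh x + (-7*x^4-12*x^2-48) < 0 := by
  refine aux_neg _ (fun x => (-x^4+24*x^2)*Real.sinh x + (-8*x^3+24*x)*Real.cosh x + (-28*x^3-24*x)) (by norm_num) (fun x => ?_) f1_neg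
  have h := aux_hd _ _ _ _ _ _ x (aux_poly (0) (-48) (0) (-4) (0) x) (aux_poly (48) (0) (36) (0) (-1) x) (aux_poly (-48) (0) (-12) (0) (-7) x)
  convert h using 1
  · funext y; ring
  · ring

/-- The auxiliary function η vanishes at R and is negative on (0,R). -/
theorem stmt_17 (R : ℝ) (hR : 0 < R) :
    let η : ℝ → ℝ := fun s =>
      (s ^ 4 - 8 * R * s ^ 3 + 6 * (R ^ 2 + 1) * s ^ 2 + 2 * (R ^ 3 - 3 * R) * s - R ^ 4)
        * Real.sinh (2 * (R - s))
      + (-2 * R * s ^ 4 + (3 * R ^ 2 + 4) * s ^ 3 - 12 * R * s ^ 2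
          + (-R ^ 4 + 3 * R ^ 2 + 3) * s + 2 * R ^ 3) * Real.cosh (2 * (R - s))
      - (R ^ 2 - 2) * s ^ 3 + (3 * R ^ 4 + 3 * R ^ 2 - 3) * s - 2 * R ^ 5 - 2 * R ^ 3
    η R = 0 ∧ ∀ s : ℝ, 0 < s → s < R → η s < 0 := by
  intro η
  refine ⟨by simp only [η]; norm_num; ring, ?_⟩
  intro s hs hsR
  obtain ⟨t, rfl⟩ : ∃ t, R = s + t := ⟨R - s, by ring⟩
  have ht : 0 < t := by linarith
  have e : 2 * (s + t - s) = 2 * t := by ring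
  simp only [η, e]
  have hg := g0_neg (2*t) (by linarith)
  have hh := h_neg (2*t) (by linarith)
  have hf := f0_neg (2*t) (by linarith)
  have h1 := Real.sinh_two_mul t
  have h2 := Real.cosh_two_mul t
  have h3 := Real.cosh_sq t
  have c3 : 6*t*Real.sinh (2*t) - (3*t^2+3)*Real.cosh (2*t) - 3*t^2+3 ≤ 0 := by
    have : 6*t*Real.sinh (2*t) - (3*t^2+3)*Real.cosh (2*t) - 3*t^2+3
        = -6*(t*Real.cosh t - Real.sinh t)^2 := by
      rw [h1, h2]
      linear_combination (3*t^2-3) * h3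
    rw [this]
    nlinarith [sq_nonneg (t*Real.cosh t - Real.sinh t)]
  have k3 := mul_nonneg (pow_pos hs 3).le (neg_nonneg.2 c3)
  have k2 := mul_pos (mul_pos (pow_pos hs 2) (pow_pos ht 2)) (neg_pos.2 hg)
  have k1 := mul_pos hs (neg_pos.2 hf)
  have k0 := mul_pos (pow_pos ht 3) (neg_pos.2 hh)
  generalize Real.sinh (2*t) = S at *
  generalize Real.cosh (2*t) = C at *
  linear_combination k3 + 2*k2 + (1/16)*k1 + (1/2)*k0
end
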